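/- Let q = 3^d with d even and positive, let K be a finite field with q elements, and let b, c ∈ K with b a nonsquare (in particular b ≠ 0). Then the number of pairs (x, y) ∈ K × K with y^2 = x^3 − bx + c equals q. (Equivalently, the elliptic curve y^2 = x^3 − bx + c over F_q has trace of Frobenius 0.) -/

import Mathlib

/-- In characteristic three, `x ↦ x³ - bx` is injective when `b` is not a square. -/
theorem injective_cube_sub_mul {K : Type*} [Field K] (h3 : (3 : K) = 0) {b : K}
    (hb : ¬∃ s : K, b = s ^ 2) : Function.Injective fun x : K => x ^ 3 - b * x := by
  intro x y hxy
  have h : (x - y) * ((x - y) ^ 2 - b) = 0 := by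
    linear_combination hxy - x * y * (x - y) * h3
  rcases mul_eq_zero.mp h with h | h
  · exact sub_eq_zero.mp h
  · exact absurd ⟨x - y, (sub_eq_zero.mp h).symm⟩ hb

/-- If `f` is a bijection, the curve `g y = f x + c` has one point for each `y`. -/
theorem card_eq_of_bijective {K : Type*} [AddGroup K] {f : K → K}
    (hf : Function.Bijective f) (g : K → K) (c : K) :
    Nat.card {P : K × K // g P.2 = f P.1 + c} = Nat.card K := by
  refine Nat.card_eq_of_bijective (fun P => P.1.2) ⟨?_, fun y => ?_⟩
  · rintro ⟨⟨x, y⟩, h⟩ ⟨⟨x', y'⟩, h'⟩ (rfl : y = y')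
    obtain rfl : x = x' := hf.1 (add_right_cancel (h.symm.trans h'))
    rfl
  · obtain ⟨x, hx⟩ := hf.2 (g y - c)
    exact ⟨⟨(x, y), by simp [hx]⟩, rfl⟩

/-- Point counts for supersingular elliptic curves `y² = x³ - bx + c` over `F_q`,
`q = 3^d` with `d` even and positive, when `b` is a nonsquare: the number of affine
points is `q` (the trace of Frobenius is 0). -/
theorem stmt_17 (d : ℕ) (hd : Even d) (hd0 : 0 < d) (q : ℕ) (hq : q = 3 ^ d)
    (K : Type*) [Field K] [Fintype K] (hK : Fintype.card K = q)
    (b c : K) (hb : ¬∃ s : K, b = s ^ 2) :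
    Nat.card {P : K × K // P.2 ^ 2 = P.1 ^ 3 - b * P.1 + c} = q := by
  have h3 : (3 : K) = 0 := by
    have h : ((Fintype.card K : ℕ) : K) = 0 := Nat.cast_card_eq_zero K
    rw [hK, hq] at h
    push_cast at h
    exact eq_zero_of_pow_eq_zero h
  have hf := Finite.injective_iff_bijective.mp (injective_cube_sub_mul h3 hb)
  rw [card_eq_of_bijective hf (fun y => y ^ 2) c, Nat.card_eq_fintype_card, hK]
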